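/- arXiv:2509.20122 — 4 statements merged into one kernel-verified Lean document; each statement's English description precedes it below -/
import Mathlib

section
/- Let Ω ⊆ ℝ^d be open with 0 ∈ Ω. Let v : Ω → [0,∞) satisfy v(0) = 0, let v be twice differentiable on Ω with second derivative D²v continuous at 0; let f : Ω → ℝ^d be differentiable at 0 with f(0) = 0; let c_1, …, c_r : Ω → ℝ be differentiable at 0 with c_i(0) = 0; and let b : Ω → ℝ^d be continuous at 0. Suppose v satisfies the Hamilton–Jacobi–Bellman equation ∇v(z)ᵀ f(z) + Σ_{i=1}^r c_i(z)² − (1/4)·( b(z)ᵀ∇v(z) )² = 0 for every z ∈ Ω. Then, with P := (1/2)·D²v(0), one has v(z) = zᵀ P z + o(‖z‖²) as z → 0, and P solves the algebraic Riccati equation Df(0)ᵀ P + P·Df(0) − P·b(0)·b(0)ᵀ·P + Q = 0, where Q := Σ_{i=1}^r ∇c_i(0)·∇c_i(0)ᵀ. -/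
open scoped RealInnerProductSpace

section InnerProductSpace

variable {E : Type*} [NormedAddCommGroup E] [InnerProductSpace ℝ E]

theorem HasFDerivAt.tendsto_inv_smul_apply_smul {F : Type*} [NormedAddCommGroup F]
    [NormedSpace ℝ F] {g : E → F} {g' : E →L[ℝ] F} (hg : HasFDerivAt g g' 0) (hg0 : g 0 = 0)
    (z : E) :
    Filter.Tendsto (fun t : ℝ => t⁻¹ • g (t • z)) (nhdsWithin 0 {0}ᶜ) (nhds (g' z)) := by
  simpa [hg0] using (hg.hasLineDerivAt z).tendsto_slope_zero

variable [CompleteSpace E]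

theorem inner_apply_eq_inner_apply_of_hasGradientAt {v : E → ℝ} {G : E → E} {H : E →L[ℝ] E}
    {x : E} (hG : ∀ᶠ z in nhds x, HasGradientAt v (G z) z) (hH : HasFDerivAt G H x) (y z : E) :
    ⟪H y, z⟫ = ⟪y, H z⟫ := by
  have h := second_derivative_symmetric_of_eventually (𝕜 := ℝ) (f := v)
    (f' := fun z => innerSL ℝ (G z)) (f'' := (innerSL ℝ).comp H) (x := x)
    (hG.mono fun z hz => hz.hasFDerivAt)
    ((innerSL ℝ).hasFDerivAt.comp x hH) y z
  simp only [ContinuousLinearMap.comp_apply, innerSL_apply_apply] at h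
  rw [h, real_inner_comm]

/-- The second-order Taylor expansion at a critical point where `v` vanishes. -/
theorem isLittleO_sub_inner_half_hessian {v : E → ℝ} {G : E → E} {H : E →L[ℝ] E}
    (hv0 : v 0 = 0) (hG0 : G 0 = 0)
    (hG : ∀ᶠ z in nhds (0 : E), HasGradientAt v (G z) z) (hH : HasFDerivAt G H 0) :
    (fun z => v z - ⟪z, ((1 / 2 : ℝ) • H) z⟫) =o[nhds (0 : E)] fun z => ‖z‖ ^ 2 := by
  have hsymm := inner_apply_eq_inner_apply_of_hasGradientAt hG hH
  rw [Asymptotics.isLittleO_iff]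
  intro ε hε
  have hlin : ∀ᶠ z in nhds (0 : E), ‖G z - H z‖ ≤ ε * ‖z‖ := by
    have h := (hasFDerivAt_iff_isLittleO_nhds_zero.1 hH).def hε
    simpa [hG0] using h
  obtain ⟨δ, hδ, hball⟩ := Metric.eventually_nhds_iff_ball.1 (hG.and hlin)
  filter_upwards [Metric.ball_mem_nhds (0 : E) hδ] with z hz
  have hsub : ∀ y ∈ Metric.closedBall (0 : E) ‖z‖, y ∈ Metric.ball (0 : E) δ := by
    intro y hy
    rw [mem_closedBall_zero_iff] at hy
    rw [mem_ball_zero_iff] at hz ⊢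
    exact hy.trans_lt hz
  have hder : ∀ y ∈ Metric.closedBall (0 : E) ‖z‖,
      HasFDerivWithinAt (fun z => v z - ⟪z, ((1 / 2 : ℝ) • H) z⟫)
        (innerSL ℝ (G y - H y)) (Metric.closedBall (0 : E) ‖z‖) y := by
    intro y hy
    have h := (hball y (hsub y hy)).1.hasFDerivAt.sub
      ((hasFDerivAt_id y).inner ℝ ((1 / 2 : ℝ) • H).hasFDerivAt)
    refine (h.congr_fderiv ?_).hasFDerivWithinAt
    ext w
    have := hsymm y w
    have := real_inner_comm w (H y)
    simp [inner_smul_right]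
    linarith
  have hmean := (convex_closedBall (0 : E) ‖z‖).norm_image_sub_le_of_norm_hasFDerivWithin_le
    (C := ε * ‖z‖) hder
    (fun y hy => by
      rw [innerSL_apply_norm]
      exact (hball y (hsub y hy)).2.trans
        (mul_le_mul_of_nonneg_left (mem_closedBall_zero_iff.1 hy) hε.le))
    (Metric.mem_closedBall_self (norm_nonneg z)) (mem_closedBall_zero_iff.2 le_rfl)
  simpa [hv0, pow_two, mul_assoc] using hmean

/-- The second-order part at the origin of the Hamilton–Jacobi–Bellman equation. -/
theorem quadratic_part_hamiltonJacobiBellman {ι : Type*} [Fintype ι] {G f b : E → E}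
    {H A : E →L[ℝ] E} {c : ι → E → ℝ} {gc : ι → E}
    (hG0 : G 0 = 0) (hH : HasFDerivAt G H 0) (hf0 : f 0 = 0) (hA : HasFDerivAt f A 0)
    (hc0 : ∀ i, c i 0 = 0) (hgc : ∀ i, HasGradientAt (c i) (gc i) 0) (hb : ContinuousAt b 0)
    (hHJB : ∀ᶠ z in nhds (0 : E),
      ⟪G z, f z⟫ + (∑ i, (c i z) ^ 2) - (1 / 4) * ⟪b z, G z⟫ ^ 2 = 0) (z : E) :
    ⟪H z, A z⟫ + (∑ i, ⟪gc i, z⟫ ^ 2) - (1 / 4) * ⟪b 0, H z⟫ ^ 2 = 0 := by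
  have hray : Filter.Tendsto (fun t : ℝ => t • z) (nhdsWithin 0 {0}ᶜ) (nhds 0) :=
    ((continuous_id.smul continuous_const).tendsto' (0 : ℝ) (0 : E) (zero_smul ℝ z)).mono_left
      nhdsWithin_le_nhds
  have hGt := hH.tendsto_inv_smul_apply_smul hG0 z
  have hft := hA.tendsto_inv_smul_apply_smul hf0 z
  have hct := fun i => (hgc i).hasFDerivAt.tendsto_inv_smul_apply_smul (hc0 i) z
  have hbt := hb.tendsto.comp hray
  have hlim := ((hGt.inner hft).add
    (tendsto_finsetSum Finset.univ fun i _ => (hct i).pow 2)).sub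
    (((hbt.inner hGt).pow 2).const_mul (1 / 4 : ℝ))
  simp only [InnerProductSpace.toDual_apply_apply] at hlim
  refine tendsto_nhds_unique hlim (tendsto_const_nhds.congr' ?_)
  filter_upwards [hray.eventually hHJB] with t ht
  have hscale : (t⁻¹) ^ 2 * (⟪G (t • z), f (t • z)⟫ + (∑ i, (c i (t • z)) ^ 2)
      - (1 / 4) * ⟪b (t • z), G (t • z)⟫ ^ 2) = 0 := by rw [ht, mul_zero]
  rw [← hscale, mul_sub, mul_add, Finset.mul_sum]
  simp only [Function.comp_apply, real_inner_smul_left, real_inner_smul_right, smul_eq_mul,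
    mul_pow]
  ring

open ContinuousLinearMap in
theorem riccati_eq_zero_of_quadratic_form {ι : Type*} [Fintype ι] {P A : E →L[ℝ] E} {b : E}
    {g : ι → E} (hP : ∀ y z, ⟪P y, z⟫ = ⟪y, P z⟫)
    (hquad : ∀ z, 2 * ⟪P z, A z⟫ + (∑ i, ⟪g i, z⟫ ^ 2) - ⟪b, P z⟫ ^ 2 = 0) :
    (adjoint A).comp P + P.comp A - P.comp (((innerSL ℝ b).smulRight b).comp P) +
      (∑ i, (innerSL ℝ (g i)).smulRight (g i)) = 0 := by
  set S := (adjoint A).comp P + P.comp A - P.comp (((innerSL ℝ b).smulRight b).comp P) +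
      (∑ i, (innerSL ℝ (g i)).smulRight (g i)) with hS
  have hform : ∀ y z, ⟪S y, z⟫ = ⟪P y, A z⟫ + ⟪A y, P z⟫ - ⟪b, P y⟫ * ⟪b, P z⟫
      + ∑ i, ⟪g i, y⟫ * ⟪g i, z⟫ := by
    intro y z
    simp [hS, inner_add_left, inner_sub_left, adjoint_inner_left, hP, sum_inner,
      real_inner_smul_left, sum_apply]
  have hsymm : (S : E →ₗ[ℝ] E).IsSymmetric := by
    intro y z
    simp only [coe_coe]
    rw [real_inner_comm (S z) y, hform, hform, real_inner_comm (A y) (P z),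
      real_inner_comm (P y) (A z)]
    simp only [mul_comm]
    ring
  have hzero := hsymm.inner_map_self_eq_zero.1 fun z => by
    rw [coe_coe, hform, real_inner_comm (P z) (A z)]
    have := hquad z
    simp only [pow_two] at this
    linarith
  ext z
  exact congrArg (fun T : E →ₗ[ℝ] E => T z) hzero

end InnerProductSpace

/-- Quadratic expansion of a nonnegative strong solution `v` of the HJB equation at the
origin: with `P := (1/2) D²v(0)` one has `v(z) = zᵀPz + o(‖z‖²)`, and `P` solves the
algebraic Riccati equation `Df(0)ᵀP + P Df(0) − P b(0) b(0)ᵀ P + Q = 0`, where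
`Q = Σᵢ ∇cᵢ(0) ∇cᵢ(0)ᵀ`. -/
theorem stmt_10 {d r : ℕ}
    (Ω : Set (EuclideanSpace ℝ (Fin d))) (hΩ : IsOpen Ω)
    (h0 : (0 : EuclideanSpace ℝ (Fin d)) ∈ Ω)
    (v : EuclideanSpace ℝ (Fin d) → ℝ)
    (hv0 : v 0 = 0) (hvnonneg : ∀ z ∈ Ω, 0 ≤ v z)
    (Gv : EuclideanSpace ℝ (Fin d) → EuclideanSpace ℝ (Fin d))
    (DGv : EuclideanSpace ℝ (Fin d) →
      (EuclideanSpace ℝ (Fin d) →L[ℝ] EuclideanSpace ℝ (Fin d)))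
    -- `v` is twice differentiable on `Ω` with Hessian `DGv` continuous at `0`
    (hGv : ∀ z ∈ Ω, HasGradientAt v (Gv z) z)
    (hDGv : ∀ z ∈ Ω, HasFDerivAt Gv (DGv z) z)
    (hDGvcont : ContinuousAt DGv 0)
    (f : EuclideanSpace ℝ (Fin d) → EuclideanSpace ℝ (Fin d))
    (hf0 : f 0 = 0)
    (Df0 : EuclideanSpace ℝ (Fin d) →L[ℝ] EuclideanSpace ℝ (Fin d))
    (hDf0 : HasFDerivAt f Df0 0)
    (c : Fin r → EuclideanSpace ℝ (Fin d) → ℝ)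
    (hc0 : ∀ i, c i 0 = 0)
    (gc : Fin r → EuclideanSpace ℝ (Fin d))
    (hgc : ∀ i, HasGradientAt (c i) (gc i) 0)
    (b : EuclideanSpace ℝ (Fin d) → EuclideanSpace ℝ (Fin d))
    (hbcont : ContinuousAt b 0)
    -- the Hamilton–Jacobi–Bellman equation holds on `Ω`
    (hHJB : ∀ z ∈ Ω,
      ⟪Gv z, f z⟫ + (∑ i : Fin r, (c i z) ^ 2) - (1 / 4) * ⟪b z, Gv z⟫ ^ 2 = 0) :
    ((fun z => v z - ⟪z, ((1 / 2 : ℝ) • DGv 0) z⟫)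
        =o[nhds (0 : EuclideanSpace ℝ (Fin d))] fun z => ‖z‖ ^ 2) ∧
    (ContinuousLinearMap.adjoint Df0).comp ((1 / 2 : ℝ) • DGv 0) +
        ((1 / 2 : ℝ) • DGv 0).comp Df0 -
        (((1 / 2 : ℝ) • DGv 0).comp
          (((innerSL ℝ (b 0)).smulRight (b 0)).comp ((1 / 2 : ℝ) • DGv 0))) +
        (∑ i : Fin r, (innerSL ℝ (gc i)).smulRight (gc i)) = 0 := by
  have hΩ0 : ∀ᶠ z in nhds 0, z ∈ Ω := hΩ.mem_nhds h0
  have hG0 : Gv 0 = 0 := by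
    have hmin : IsLocalMin v 0 := hΩ0.mono fun z hz => hv0 ▸ hvnonneg z hz
    simpa using hmin.hasFDerivAt_eq_zero (hGv 0 h0).hasFDerivAt
  have hG : ∀ᶠ z in nhds 0, HasGradientAt v (Gv z) z := hΩ0.mono hGv
  have hsymm := inner_apply_eq_inner_apply_of_hasGradientAt hG (hDGv 0 h0)
  refine ⟨isLittleO_sub_inner_half_hessian hv0 hG0 hG (hDGv 0 h0),
    riccati_eq_zero_of_quadratic_form (fun y z => ?_) fun z => ?_⟩
  · simp only [smul_apply, real_inner_smul_left, real_inner_smul_right,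
      hsymm]
  · have hquad := quadratic_part_hamiltonJacobiBellman hG0 (hDGv 0 h0) hf0 hDf0 hc0 hgc hbcont
      (hΩ0.mono hHJB) z
    simp only [smul_apply, real_inner_smul_left, real_inner_smul_right]
    linarith
end

section
/- Let H be a separable real Hilbert space and S : [0,∞) → B(H) a strongly continuous semigroup of bounded linear operators which is exponentially stable (‖S(t)‖ ≤ M·exp(−ωt) for some M ≥ 1, ω > 0), let (c_i)_{i∈ℕ} ⊆ H with Σ_i ‖c_i‖² < ∞, and define P(φ,ψ) := Σ_i ∫₀^∞ ⟨S(t)φ, c_i⟩·⟨S(t)ψ, c_i⟩ dt. Suppose (p_n)_{n∈ℕ} is an orthonormal family in H and (σ_n)_{n∈ℕ} are strictly positive reals with Σ_n σ_n < ∞ such that P(φ,ψ) = Σ_n σ_n·⟨φ, p_n⟩·⟨ψ, p_n⟩ for all φ, ψ ∈ H, and let V := closure of span{p_n : n ∈ ℕ}. Then for every t ≥ 0 the orthogonal complement V⊥ is invariant under S(t), i.e. S(t)(V⊥) ⊆ V⊥, and consequently V is invariant under the adjoints: S(t)* p_n ∈ V for every n and every t ≥ 0. -/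
open MeasureTheory
open scoped RealInnerProductSpace

section

variable {H : Type*} [NormedAddCommGroup H] [InnerProductSpace ℝ H]

theorem mem_orthogonal_closure_span_range_iff {ι : Type*} (p : ι → H) (φ : H) :
    φ ∈ (Submodule.span ℝ (Set.range p)).topologicalClosureᗮ ↔ ∀ n, ⟪φ, p n⟫ = 0 := by
  rw [Submodule.orthogonal_closure]
  refine ⟨fun h n => ?_, fun h => ?_⟩
  · rw [real_inner_comm]
    exact (Submodule.mem_orthogonal _ _).1 h _ (Submodule.subset_span ⟨n, rfl⟩)
  · rw [Submodule.mem_orthogonal']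
    intro u hu
    induction hu using Submodule.span_induction with
    | mem x hx => obtain ⟨n, rfl⟩ := hx; exact h n
    | zero => simp
    | add x y _ _ hx hy => rw [inner_add_right, hx, hy, add_zero]
    | smul a x _ hx => rw [inner_smul_right, hx, mul_zero]

variable {S : ℝ → H →L[ℝ] H} {M ω : ℝ}

theorem inner_mul_inner_le_of_norm_le_exp
    (hstab : ∀ t : ℝ, 0 ≤ t → ‖S t‖ ≤ M * Real.exp (-ω * t)) (φ c : H) {t : ℝ} (ht : 0 ≤ t) :
    ⟪S t φ, c⟫ * ⟪S t φ, c⟫ ≤ (M * ‖φ‖ * ‖c‖) ^ 2 * Real.exp (-(2 * ω) * t) := by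
  have h : |⟪S t φ, c⟫| ≤ M * Real.exp (-ω * t) * ‖φ‖ * ‖c‖ :=
    (abs_real_inner_le_norm _ _).trans <| by
      gcongr
      exact (S t).le_of_opNorm_le (hstab t ht) φ
  calc ⟪S t φ, c⟫ * ⟪S t φ, c⟫ = |⟪S t φ, c⟫| ^ 2 := by rw [sq_abs, sq]
    _ ≤ (M * Real.exp (-ω * t) * ‖φ‖ * ‖c‖) ^ 2 := by gcongr
    _ = (M * ‖φ‖ * ‖c‖) ^ 2 * Real.exp (-(2 * ω) * t) := by
      have : Real.exp (-(2 * ω) * t) = Real.exp (-ω * t) ^ 2 := by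
        rw [← Real.exp_nat_mul]; congr 1; push_cast; ring
      rw [this]; ring

theorem integrableOn_inner_mul_inner
    (hScont : ∀ φ : H, ContinuousOn (fun t => S t φ) (Set.Ici (0 : ℝ))) (hω : 0 < ω)
    (hstab : ∀ t : ℝ, 0 ≤ t → ‖S t‖ ≤ M * Real.exp (-ω * t)) (φ c : H) :
    IntegrableOn (fun t => ⟪S t φ, c⟫ * ⟪S t φ, c⟫) (Set.Ioi (0 : ℝ)) := by
  have hcont : ContinuousOn (fun t => ⟪S t φ, c⟫) (Set.Ioi (0 : ℝ)) :=
    ((hScont φ).mono Set.Ioi_subset_Ici_self).inner continuousOn_const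
  refine Integrable.mono' ((integrableOn_exp_mul_Ioi (a := -(2 * ω)) (by linarith) 0).const_mul
    ((M * ‖φ‖ * ‖c‖) ^ 2)) ((hcont.mul hcont).aestronglyMeasurable measurableSet_Ioi) ?_
  refine (ae_restrict_iff' measurableSet_Ioi).2 (.of_forall fun t ht => ?_)
  rw [Real.norm_of_nonneg (mul_self_nonneg _)]
  exact inner_mul_inner_le_of_norm_le_exp hstab φ c (le_of_lt ht)

theorem summable_integral_inner_mul_inner
    (hScont : ∀ φ : H, ContinuousOn (fun t => S t φ) (Set.Ici (0 : ℝ))) (hω : 0 < ω)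
    (hstab : ∀ t : ℝ, 0 ≤ t → ‖S t‖ ≤ M * Real.exp (-ω * t))
    {ι : Type*} {c : ι → H} (hc : Summable fun i => ‖c i‖ ^ 2) (φ : H) :
    Summable fun i => ∫ t in Set.Ioi (0 : ℝ), ⟪S t φ, c i⟫ * ⟪S t φ, c i⟫ := by
  refine Summable.of_nonneg_of_le (fun i => integral_nonneg fun t => mul_self_nonneg _)
    (fun i => ?_)
    (hc.mul_left ((M * ‖φ‖) ^ 2 * ∫ t in Set.Ioi (0 : ℝ), Real.exp (-(2 * ω) * t)))
  calc ∫ t in Set.Ioi (0 : ℝ), ⟪S t φ, c i⟫ * ⟪S t φ, c i⟫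
      ≤ ∫ t in Set.Ioi (0 : ℝ), (M * ‖φ‖ * ‖c i‖) ^ 2 * Real.exp (-(2 * ω) * t) :=
        setIntegral_mono_on (integrableOn_inner_mul_inner hScont hω hstab φ (c i))
          ((integrableOn_exp_mul_Ioi (by linarith) 0).const_mul _) measurableSet_Ioi
          fun t ht => inner_mul_inner_le_of_norm_le_exp hstab φ (c i) (le_of_lt ht)
    _ = _ := by rw [integral_const_mul]; ring

theorem integral_inner_mul_inner_apply_le
    (hSsem : ∀ s t : ℝ, 0 ≤ s → 0 ≤ t → S (t + s) = (S t).comp (S s)) (φ c : H)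
    (hint : IntegrableOn (fun t => ⟪S t φ, c⟫ * ⟪S t φ, c⟫) (Set.Ioi (0 : ℝ)))
    {s : ℝ} (hs : 0 ≤ s) :
    ∫ t in Set.Ioi (0 : ℝ), ⟪S t (S s φ), c⟫ * ⟪S t (S s φ), c⟫ ≤
      ∫ t in Set.Ioi (0 : ℝ), ⟪S t φ, c⟫ * ⟪S t φ, c⟫ := by
  calc ∫ t in Set.Ioi (0 : ℝ), ⟪S t (S s φ), c⟫ * ⟪S t (S s φ), c⟫
      = ∫ t in Set.Ioi (0 : ℝ), ⟪S (t + s) φ, c⟫ * ⟪S (t + s) φ, c⟫ := by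
        refine setIntegral_congr_fun measurableSet_Ioi fun t ht => ?_
        simp only [hSsem s t hs (le_of_lt ht), ContinuousLinearMap.comp_apply]
    _ = ∫ t in Set.Ioi s, ⟪S t φ, c⟫ * ⟪S t φ, c⟫ := by
        have h := (measurePreserving_add_right volume s).setIntegral_preimage_emb
          (measurableEmbedding_addRight s) (fun t => ⟪S t φ, c⟫ * ⟪S t φ, c⟫) (Set.Ioi s)
        rwa [Set.preimage_add_const_Ioi, sub_self] at h
    _ ≤ _ := setIntegral_mono_set hint (.of_forall fun t => mul_self_nonneg _)
        (Set.Ioi_subset_Ioi hs).eventuallyLE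

end

/-- Invariance of the closed span `V` of the eigenfunctions (with positive eigenvalue)
of the value bilinear form: the orthogonal complement `V⊥` is invariant under `S(t)` and
hence `V` is invariant under the adjoints `S(t)*`. -/
theorem stmt_13 {H : Type*} [NormedAddCommGroup H] [InnerProductSpace ℝ H]
    [CompleteSpace H] [TopologicalSpace.SeparableSpace H]
    (S : ℝ → H →L[ℝ] H)
    (hS0 : S 0 = ContinuousLinearMap.id ℝ H)
    (hSsem : ∀ s t : ℝ, 0 ≤ s → 0 ≤ t → S (t + s) = (S t).comp (S s))
    (hScont : ∀ φ : H, ContinuousOn (fun t => S t φ) (Set.Ici (0 : ℝ)))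
    (M ω : ℝ) (hM : 1 ≤ M) (hω : 0 < ω)
    (hstab : ∀ t : ℝ, 0 ≤ t → ‖S t‖ ≤ M * Real.exp (-ω * t))
    (c : ℕ → H) (hc : Summable fun i => ‖c i‖ ^ 2)
    (p : ℕ → H) (σ : ℕ → ℝ) (hp : Orthonormal ℝ p)
    (hσpos : ∀ n, 0 < σ n) (hσsum : Summable σ)
    (hdecomp : ∀ φ ψ : H,
      HasSum (fun n => σ n * ⟪φ, p n⟫ * ⟪ψ, p n⟫)
        (∑' i, ∫ t in Set.Ioi (0 : ℝ), ⟪S t φ, c i⟫ * ⟪S t ψ, c i⟫))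
    (V : Submodule ℝ H)
    (hV : V = (Submodule.span ℝ (Set.range p)).topologicalClosure) :
    (∀ t : ℝ, 0 ≤ t → ∀ φ ∈ Vᗮ, S t φ ∈ Vᗮ) ∧
    (∀ t : ℝ, 0 ≤ t → ∀ n : ℕ, ContinuousLinearMap.adjoint (S t) (p n) ∈ V) := by
  have hinv : ∀ t : ℝ, 0 ≤ t → ∀ φ ∈ Vᗮ, S t φ ∈ Vᗮ := by
    subst hV
    intro s hs φ hφ
    rw [mem_orthogonal_closure_span_range_iff] at hφ ⊢
    have hsum : ∑' i, ∫ t in Set.Ioi (0 : ℝ), ⟪S t φ, c i⟫ * ⟪S t φ, c i⟫ = 0 :=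
      (hdecomp φ φ).unique (by simp [hφ, hasSum_zero])
    have hzero : ∀ i, ∫ t in Set.Ioi (0 : ℝ), ⟪S t φ, c i⟫ * ⟪S t φ, c i⟫ = 0 := by
      have h := (summable_integral_inner_mul_inner hScont hω hstab hc φ).hasSum
      rw [hsum, hasSum_zero_iff_of_nonneg fun i => integral_nonneg fun t => mul_self_nonneg _] at h
      exact congrFun h
    have hzero' : ∀ i, ∫ t in Set.Ioi (0 : ℝ), ⟪S t (S s φ), c i⟫ * ⟪S t (S s φ), c i⟫ = 0 :=
      fun i => le_antisymm ((integral_inner_mul_inner_apply_le hSsem φ (c i)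
        (integrableOn_inner_mul_inner hScont hω hstab φ (c i)) hs).trans_eq (hzero i))
        (integral_nonneg fun t => mul_self_nonneg _)
    have h := hdecomp (S s φ) (S s φ)
    simp only [hzero', tsum_zero, mul_assoc] at h
    rw [hasSum_zero_iff_of_nonneg fun n => mul_nonneg (hσpos n).le (mul_self_nonneg _)] at h
    intro n
    simpa [(hσpos n).ne'] using congrFun h n
  refine ⟨hinv, fun t ht n => ?_⟩
  have hVclosed : IsClosed (V : Set H) := by
    rw [hV]; exact Submodule.isClosed_topologicalClosure _
  have : CompleteSpace V := hVclosed.completeSpace_coe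
  rw [← Submodule.orthogonal_orthogonal V, Submodule.mem_orthogonal]
  intro φ hφ
  rw [ContinuousLinearMap.adjoint_inner_right]
  have h := hinv t ht φ hφ
  rw [hV, mem_orthogonal_closure_span_range_iff] at h
  exact h n
end

section
/- Let H be a separable real Hilbert space and S : [0,∞) → B(H) a strongly continuous semigroup of bounded linear operators which is exponentially stable (‖S(t)‖ ≤ M·exp(−ωt) for some M ≥ 1, ω > 0), let (c_i)_{i∈ℕ} ⊆ H with Σ_i ‖c_i‖² < ∞, and define P(φ,ψ) := Σ_i ∫₀^∞ ⟨S(t)φ, c_i⟩·⟨S(t)ψ, c_i⟩ dt. Suppose (p_n)_{n∈ℕ} is an orthonormal family in H and (σ_n)_{n∈ℕ} are strictly positive reals with Σ_n σ_n < ∞ such that P(φ,ψ) = Σ_n σ_n·⟨φ, p_n⟩·⟨ψ, p_n⟩ for all φ, ψ ∈ H, and let V := closure of span{p_n : n ∈ ℕ}. Then every observable lies in V: c_i ∈ V for all i ∈ ℕ. Equivalently, ⟨φ, c_i⟩ = 0 for all i whenever φ ⊥ V. -/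
open MeasureTheory
open scoped RealInnerProductSpace

/-- A continuous function on `[0, ∞)` with integrable square whose square integrates to zero
vanishes at the origin. -/
theorem eq_zero_of_setIntegral_mul_self_eq_zero {f : ℝ → ℝ}
    (hf : ContinuousOn f (Set.Ici 0))
    (hint : IntegrableOn (fun t => f t * f t) (Set.Ioi 0))
    (h0 : ∫ t in Set.Ioi (0 : ℝ), f t * f t = 0) : f 0 = 0 := by
  have hae : (fun t => f t * f t) =ᵐ[volume.restrict (Set.Ioi 0)] fun _ => (0 : ℝ) :=
    (integral_eq_zero_iff_of_nonneg (fun t => mul_self_nonneg (f t)) hint).1 h0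
  have hcont : ContinuousOn (fun t => f t * f t) (Set.Ici 0) := hf.mul hf
  have hIoi : Set.EqOn (fun t => f t * f t) (fun _ => 0) (Set.Ioi 0) :=
    Measure.eqOn_open_of_ae_eq hae isOpen_Ioi (hcont.mono Set.Ioi_subset_Ici_self)
      continuousOn_const
  have hIci : Set.EqOn (fun t => f t * f t) (fun _ => 0) (Set.Ici 0) :=
    hIoi.of_subset_closure hcont continuousOn_const Set.Ioi_subset_Ici_self
      (closure_Ioi (0 : ℝ)).ge
  exact mul_self_eq_zero.1 (hIci Set.self_mem_Ici)

/-- Every observable `cᵢ` lies in the closed span `V` of the eigenfunctions (with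
positive eigenvalue) of the value bilinear form; equivalently `⟨φ, cᵢ⟩ = 0` for all `i`
whenever `φ ⊥ V`. -/
theorem stmt_14 {H : Type*} [NormedAddCommGroup H] [InnerProductSpace ℝ H]
    [CompleteSpace H] [TopologicalSpace.SeparableSpace H]
    (S : ℝ → H →L[ℝ] H)
    (hS0 : S 0 = ContinuousLinearMap.id ℝ H)
    (hSsem : ∀ s t : ℝ, 0 ≤ s → 0 ≤ t → S (t + s) = (S t).comp (S s))
    (hScont : ∀ φ : H, ContinuousOn (fun t => S t φ) (Set.Ici (0 : ℝ)))
    (M ω : ℝ) (hM : 1 ≤ M) (hω : 0 < ω)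
    (hstab : ∀ t : ℝ, 0 ≤ t → ‖S t‖ ≤ M * Real.exp (-ω * t))
    (c : ℕ → H) (hc : Summable fun i => ‖c i‖ ^ 2)
    (p : ℕ → H) (σ : ℕ → ℝ) (hp : Orthonormal ℝ p)
    (hσpos : ∀ n, 0 < σ n) (hσsum : Summable σ)
    (hdecomp : ∀ φ ψ : H,
      HasSum (fun n => σ n * ⟪φ, p n⟫ * ⟪ψ, p n⟫)
        (∑' i, ∫ t in Set.Ioi (0 : ℝ), ⟪S t φ, c i⟫ * ⟪S t ψ, c i⟫))
    (V : Submodule ℝ H)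
    (hV : V = (Submodule.span ℝ (Set.range p)).topologicalClosure) :
    (∀ i : ℕ, c i ∈ V) ∧ (∀ φ ∈ Vᗮ, ∀ i : ℕ, ⟪φ, c i⟫ = 0) := by
  have hVclosed : IsClosed (V : Set H) := by
    rw [hV]
    exact Submodule.isClosed_topologicalClosure _
  have hpV : ∀ n, p n ∈ V := fun n => by
    rw [hV]
    exact Submodule.le_topologicalClosure _ (Submodule.subset_span ⟨n, rfl⟩)
  have hperp : ∀ φ ∈ Vᗮ, ∀ i : ℕ, ⟪φ, c i⟫ = 0 := by
    intro φ hφ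
    have hexp : IntegrableOn (fun t : ℝ => Real.exp (-(2 * ω) * t)) (Set.Ioi 0) :=
      exp_neg_integrableOn_Ioi 0 (by positivity)
    have hcont : ∀ i, ContinuousOn (fun t => ⟪S t φ, c i⟫) (Set.Ici (0 : ℝ)) := fun i =>
      (hScont φ).inner continuousOn_const
    have hbound : ∀ i, ∀ t ∈ Set.Ioi (0 : ℝ), ⟪S t φ, c i⟫ * ⟪S t φ, c i⟫ ≤
        (M * ‖φ‖) ^ 2 * ‖c i‖ ^ 2 * Real.exp (-(2 * ω) * t) := by
      intro i t ht
      have hle : |⟪S t φ, c i⟫| ≤ M * Real.exp (-ω * t) * ‖φ‖ * ‖c i‖ :=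
        (abs_real_inner_le_norm _ _).trans <| mul_le_mul_of_nonneg_right
          ((S t).le_of_opNorm_le (hstab t (Set.mem_Ioi.1 ht).le) φ) (norm_nonneg _)
      calc ⟪S t φ, c i⟫ * ⟪S t φ, c i⟫ = |⟪S t φ, c i⟫| * |⟪S t φ, c i⟫| :=
            (abs_mul_abs_self _).symm
        _ ≤ (M * Real.exp (-ω * t) * ‖φ‖ * ‖c i‖) * (M * Real.exp (-ω * t) * ‖φ‖ * ‖c i‖) :=
            mul_self_le_mul_self (abs_nonneg _) hle
        _ = (M * ‖φ‖) ^ 2 * ‖c i‖ ^ 2 * (Real.exp (-ω * t) * Real.exp (-ω * t)) := by ring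
        _ = (M * ‖φ‖) ^ 2 * ‖c i‖ ^ 2 * Real.exp (-(2 * ω) * t) := by
            rw [← Real.exp_add]
            ring_nf
    have hint : ∀ i, IntegrableOn (fun t => ⟪S t φ, c i⟫ * ⟪S t φ, c i⟫) (Set.Ioi (0 : ℝ)) := by
      intro i
      refine Integrable.mono' (hexp.const_mul ((M * ‖φ‖) ^ 2 * ‖c i‖ ^ 2)) ?_ ?_
      · exact (((hcont i).mul (hcont i)).mono Set.Ioi_subset_Ici_self).aestronglyMeasurable
          measurableSet_Ioi
      · filter_upwards [ae_restrict_mem measurableSet_Ioi] with t ht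
        rw [Real.norm_of_nonneg (mul_self_nonneg _)]
        exact hbound i t ht
    have hnonneg : ∀ i, 0 ≤ ∫ t in Set.Ioi (0 : ℝ), ⟪S t φ, c i⟫ * ⟪S t φ, c i⟫ := fun i =>
      integral_nonneg fun t => mul_self_nonneg _
    have hsum : Summable fun i => ∫ t in Set.Ioi (0 : ℝ), ⟪S t φ, c i⟫ * ⟪S t φ, c i⟫ := by
      refine Summable.of_nonneg_of_le hnonneg (fun i => ?_) ((hc.mul_left ((M * ‖φ‖) ^ 2)).mul_right
        (∫ t in Set.Ioi (0 : ℝ), Real.exp (-(2 * ω) * t)))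
      rw [← integral_const_mul]
      exact setIntegral_mono_on (hint i) (hexp.const_mul _) measurableSet_Ioi (hbound i)
    have htsum : ∑' i, ∫ t in Set.Ioi (0 : ℝ), ⟪S t φ, c i⟫ * ⟪S t φ, c i⟫ = 0 := by
      refine (hdecomp φ φ).unique ?_
      simp [fun n => Submodule.inner_left_of_mem_orthogonal (hpV n) hφ]
    have hzero := (hasSum_zero_iff_of_nonneg hnonneg).1 (htsum ▸ hsum.hasSum)
    intro i
    simpa [hS0] using
      eq_zero_of_setIntegral_mul_self_eq_zero (hcont i) (hint i) (congrFun hzero i)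
  refine ⟨fun i => ?_, hperp⟩
  rw [← hVclosed.submodule_topologicalClosure_eq, ← Submodule.orthogonal_orthogonal_eq_closure]
  exact (Submodule.mem_orthogonal _ _).2 fun φ hφ => hperp φ hφ i
end

section
/- Let Ω ⊆ ℝ^d be open and bounded, let 1 ≤ p < ∞, and let w : Ω → (0,∞) be a weight such that 1/w is bounded and Lipschitz continuous on Ω (so in particular w is bounded below by a positive constant). Then the set of Lipschitz continuous functions φ : Ω → ℝ with sup_{x∈Ω} |φ(x)|·w(x) < ∞ is dense in the weighted Lebesgue space L^p(Ω, w^p·dx): for every measurable ψ : Ω → ℝ with ∫_Ω |ψ(x)|^p·w(x)^p dx < ∞ and every ε > 0 there exists such a φ with ∫_Ω |φ(x) − ψ(x)|^p·w(x)^p dx < ε^p. -/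
open MeasureTheory ENNReal

/-- The product of two bounded real functions that are Lipschitz on `s` is Lipschitz on `s`. -/
theorem lipschitzOnWith_mul_of_bounded {α : Type*} [PseudoMetricSpace α] {s : Set α}
    {f g : α → ℝ} {K L A B : NNReal} (hf : LipschitzOnWith K f s) (hg : LipschitzOnWith L g s)
    (hA : ∀ x ∈ s, |f x| ≤ A) (hB : ∀ x ∈ s, |g x| ≤ B) :
    LipschitzOnWith (A * L + B * K) (fun x => f x * g x) s := by
  refine LipschitzOnWith.of_dist_le_mul fun x hx y hy => ?_
  have h1 := hf.dist_le_mul x hx y hy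
  have h2 := hg.dist_le_mul x hx y hy
  rw [Real.dist_eq] at h1 h2 ⊢
  have key : f x * g x - f y * g y = f x * (g x - g y) + g y * (f x - f y) := by ring
  calc |f x * g x - f y * g y| ≤ |f x| * |g x - g y| + |g y| * |f x - f y| := by
        rw [key, ← abs_mul, ← abs_mul]; exact abs_add_le _ _
    _ ≤ A * (L * dist x y) + B * (K * dist x y) := by
        gcongr
        · exact hA x hx
        · exact hB y hy
    _ = _ := by push_cast; ring

/-- The `p`-th power of the `L^p` seminorm of a real function as a lower Lebesgue integral. -/
theorem lintegral_ofReal_abs_rpow {α : Type*} [MeasurableSpace α] {μ : Measure α} {p : ℝ}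
    (hp : 0 < p) (g : α → ℝ) :
    ∫⁻ x, ENNReal.ofReal (|g x| ^ p) ∂μ = eLpNorm g (ENNReal.ofReal p) μ ^ p := by
  rw [eLpNorm_eq_lintegral_rpow_enorm_toReal (by simpa using hp) ENNReal.ofReal_ne_top,
    ENNReal.toReal_ofReal hp.le, ← ENNReal.rpow_mul, one_div_mul_cancel hp.ne', ENNReal.rpow_one]
  refine lintegral_congr fun x => ?_
  rw [← ENNReal.ofReal_rpow_of_nonneg (abs_nonneg _) hp.le, ← Real.norm_eq_abs,
    ofReal_norm]

/-- Density of the weighted Lipschitz space `W^{1,∞}_w(Ω)` (Lipschitz functions `φ` with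
`sup |φ|·w < ∞`) in the weighted Lebesgue space `L^p(Ω, wᵖ dx)` for `1 ≤ p < ∞`. -/
theorem stmt_15 {d : ℕ}
    (Ω : Set (EuclideanSpace ℝ (Fin d))) (hΩopen : IsOpen Ω)
    (hΩbdd : Bornology.IsBounded Ω)
    (p : ℝ) (hp : 1 ≤ p)
    (w : EuclideanSpace ℝ (Fin d) → ℝ)
    (hwpos : ∀ x ∈ Ω, 0 < w x)
    (hinvbdd : ∃ C : ℝ, ∀ x ∈ Ω, 1 / w x ≤ C)
    (hinvlip : ∃ K : NNReal, LipschitzOnWith K (fun x => 1 / w x) Ω) :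
    ∀ ψ : EuclideanSpace ℝ (Fin d) → ℝ, Measurable ψ →
      (∫⁻ x in Ω, ENNReal.ofReal (|ψ x| ^ p * w x ^ p)) < ⊤ →
      ∀ ε : ℝ, 0 < ε →
        ∃ φ : EuclideanSpace ℝ (Fin d) → ℝ,
          (∃ K : NNReal, LipschitzOnWith K φ Ω) ∧
          (∃ C : ℝ, ∀ x ∈ Ω, |φ x| * w x ≤ C) ∧
          (∫⁻ x in Ω, ENNReal.ofReal (|φ x - ψ x| ^ p * w x ^ p))
            < ENNReal.ofReal (ε ^ p) := by
  intro ψ hψ hint ε hε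
  obtain ⟨C, hC⟩ := hinvbdd
  obtain ⟨K, hK⟩ := hinvlip
  have hp0 : 0 < p := by linarith
  have hΩ : MeasurableSet Ω := hΩopen.measurableSet
  have hwcont : ContinuousOn w Ω := by
    have := hK.continuousOn.inv₀ fun x hx => (one_div_pos.2 (hwpos x hx)).ne'
    simpa [Pi.inv_def] using this
  set μ := volume.restrict Ω with hμ
  have hmeas : AEStronglyMeasurable (fun x => ψ x * w x) μ :=
    hψ.aestronglyMeasurable.mul (hwcont.aestronglyMeasurable hΩ)
  have hcongr : ∀ f : EuclideanSpace ℝ (Fin d) → ℝ,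
      ∫⁻ x in Ω, ENNReal.ofReal (|f x| ^ p * w x ^ p) =
        eLpNorm (fun x => f x * w x) (ENNReal.ofReal p) μ ^ p := by
    intro f
    rw [← lintegral_ofReal_abs_rpow hp0]
    refine setLIntegral_congr_fun hΩ fun x hx => ?_
    rw [abs_mul, abs_of_pos (hwpos x hx), Real.mul_rpow (abs_nonneg _) (hwpos x hx).le]
  have hmem : MemLp (fun x => ψ x * w x) (ENNReal.ofReal p) μ := by
    refine ⟨hmeas, ?_⟩
    rw [hcongr] at hint
    exact (ENNReal.rpow_lt_top_iff_of_pos hp0).1 hint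
  obtain ⟨g, hg_supp, hg_smooth, hg⟩ := hmem.exist_eLpNorm_sub_le ENNReal.ofReal_ne_top
    (by simpa using hp) (half_pos hε)
  obtain ⟨L, hL⟩ := hg_smooth.lipschitzWith_of_hasCompactSupport hg_supp (by simp)
  obtain ⟨M, hM⟩ := hg_supp.exists_bound_of_continuous hg_smooth.continuous
  refine ⟨fun x => g x * (1 / w x), ⟨_, lipschitzOnWith_mul_of_bounded (A := M.toNNReal)
    (B := C.toNNReal) hL.lipschitzOnWith hK (fun x _ => (hM x).trans (Real.le_coe_toNNReal M))
    fun x hx => ?_⟩, ⟨M, fun x hx => ?_⟩, ?_⟩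
  · rw [abs_of_pos (one_div_pos.2 (hwpos x hx))]
    exact (hC x hx).trans (Real.le_coe_toNNReal C)
  · have hw := hwpos x hx
    rw [abs_mul, abs_of_pos (one_div_pos.2 hw), mul_assoc, one_div_mul_cancel hw.ne', mul_one]
    exact hM x
  · rw [hcongr, ← ENNReal.ofReal_rpow_of_pos hε]
    refine ENNReal.rpow_lt_rpow ?_ hp0
    calc eLpNorm (fun x => (g x * (1 / w x) - ψ x) * w x) (ENNReal.ofReal p) μ
        = eLpNorm (g - fun x => ψ x * w x) (ENNReal.ofReal p) μ := by
          refine eLpNorm_congr_ae ((ae_restrict_mem hΩ).mono fun x hx => ?_)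
          have hw := (hwpos x hx).ne'
          simp only [Pi.sub_apply]
          field_simp
      _ ≤ ENNReal.ofReal (ε / 2) := by rwa [eLpNorm_sub_comm]
      _ < ENNReal.ofReal ε := (ENNReal.ofReal_lt_ofReal_iff hε).2 (half_lt_self hε)
end
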